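/- A-based nominal anti-unification is unitary: for any finite set of atoms A and any A-based nominal terms t, s of the same sort and A-based freshness context ∇, there exists an A-based least general generalization of ⟨∇, t⟩ and ⟨∇, s⟩, and it is unique modulo ≃ (any two A-based lggs p and p' of ⟨∇,t⟩ and ⟨∇,s⟩ satisfy p ≃ p'). -/

import Mathlib

set_option maxHeartbeats 1000000
abbrev Atom := ℕ
abbrev Var := ℕ
abbrev Fn := ℕ
abbrev NPerm := List (Atom × Atom)
def swapAtom (a b c : Atom) : Atom := if c = a then b else if c = b then a else c
def permAtom : NPerm → Atom → Atom
  | [], c => c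
  | (a, b) :: π, c => swapAtom a b (permAtom π c)
def permInv (π : NPerm) : NPerm := π.reverse
inductive NTerm where
  | app : Fn → List NTerm → NTerm
  | atom : Atom → NTerm
  | abs : Atom → NTerm → NTerm
  | susp : NPerm → Var → NTerm

def permTerm (π : NPerm) : NTerm → NTerm
  | .app f ts => .app f (ts.attach.map (fun x => permTerm π x.1))
  | .atom a => .atom (permAtom π a)
  | .abs a t => .abs (permAtom π a) (permTerm π t)
  | .susp ρ X => .susp (π ++ ρ) X
decreasing_by
  all_goals (simp_wf; try omega)
  all_goals (have := List.sizeOf_lt_of_mem x.2; omega)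

/-- Substitutions (total maps from variables to terms; identity almost everywhere
is not required for the statements). -/
abbrev NSubst := Var → NTerm

def idSubst : NSubst := fun X => .susp [] X

/-- Application of a substitution to a term (allowing atom capture and forcing
suspended permutations). -/
def substTerm (σ : NSubst) : NTerm → NTerm
  | .app f ts => .app f (ts.attach.map (fun x => substTerm σ x.1))
  | .atom a => .atom a
  | .abs a t => .abs a (substTerm σ t)
  | .susp π X => permTerm π (σ X)
decreasing_by
  all_goals (simp_wf; try omega)
  all_goals (have := List.sizeOf_lt_of_mem x.2; omega)

/-- Composition of substitutions: `t (σθ) = (tσ)θ`. -/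
def substComp (σ θ : NSubst) : NSubst := fun X => substTerm θ (σ X)

/-- Freshness contexts: finite sets of constraints `a # X`. -/
abbrev FCtx := Finset (Atom × Var)

/-- The freshness relation `Δ ⊢ a # t` (Urban–Pitts–Gabbay rules), stated for an
arbitrary set of freshness constraints. -/
inductive NFresh (Δ : Set (Atom × Var)) : Atom → NTerm → Prop
  | atom {a b : Atom} : a ≠ b → NFresh Δ a (.atom b)
  | susp {a : Atom} {π : NPerm} {X : Var} :
      (permAtom (permInv π) a, X) ∈ Δ → NFresh Δ a (.susp π X)
  | app {a : Atom} {f : Fn} {ts : List NTerm} :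
      (∀ t ∈ ts, NFresh Δ a t) → NFresh Δ a (.app f ts)
  | abs1 {a : Atom} {t : NTerm} : NFresh Δ a (.abs a t)
  | abs2 {a b : Atom} {t : NTerm} : a ≠ b → NFresh Δ a t → NFresh Δ a (.abs b t)

/-- The α-equivalence relation `Δ ⊢ t ≈ s` (Urban–Pitts–Gabbay rules). -/
inductive NAlpha (Δ : Set (Atom × Var)) : NTerm → NTerm → Prop
  | atom (a : Atom) : NAlpha Δ (.atom a) (.atom a)
  | abs1 {a : Atom} {t t' : NTerm} : NAlpha Δ t t' → NAlpha Δ (.abs a t) (.abs a t')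
  | abs2 {a b : Atom} {t t' : NTerm} : a ≠ b → NAlpha Δ t (permTerm [(a, b)] t') →
      NFresh Δ a t' → NAlpha Δ (.abs a t) (.abs b t')
  | susp {π π' : NPerm} {X : Var} :
      (∀ a : Atom, permAtom π a ≠ permAtom π' a → (a, X) ∈ Δ) →
      NAlpha Δ (.susp π X) (.susp π' X)
  | app {f : Fn} {ts ss : List NTerm} : ts.length = ss.length →
      (∀ p ∈ List.zip ts ss, NAlpha Δ p.1 p.2) →
      NAlpha Δ (.app f ts) (.app f ss)

/-- `FA⁻ˢ(t)`: atoms occurring freely in `t`, ignoring suspensions. -/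
def FAnoSusp : NTerm → Finset Atom
  | .app _ ts => (ts.attach.map (fun x => FAnoSusp x.1)).foldr (· ∪ ·) ∅
  | .atom a => {a}
  | .abs a t => FAnoSusp t \ {a}
  | .susp _ _ => ∅
decreasing_by
  all_goals (simp_wf; try omega)
  all_goals (have := List.sizeOf_lt_of_mem x.2; omega)

/-- A substitution respects a freshness context. -/
def Respects (σ : NSubst) (Δ : FCtx) : Prop :=
  ∀ a X, (a, X) ∈ Δ → a ∉ FAnoSusp (σ X)

/-! ### The algorithm FC -/

/-- A finite set of atomic freshness formulas `a # t`. -/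
abbrev FProb := Multiset (Atom × NTerm)

/-- One step of the algorithm FC, transforming pairs `(F; Δ)`. -/
inductive FCStep : FProb × FCtx → FProb × FCtx → Prop
  | del {a b : Atom} {F : FProb} {Δ : FCtx} : a ≠ b →
      FCStep ((a, .atom b) ::ₘ F, Δ) (F, Δ)
  | abs1 {a : Atom} {t : NTerm} {F : FProb} {Δ : FCtx} :
      FCStep ((a, .abs a t) ::ₘ F, Δ) (F, Δ)
  | abs2 {a b : Atom} {t : NTerm} {F : FProb} {Δ : FCtx} : a ≠ b →
      FCStep ((a, .abs b t) ::ₘ F, Δ) ((a, t) ::ₘ F, Δ)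
  | dec {a : Atom} {f : Fn} {ts : List NTerm} {F : FProb} {Δ : FCtx} :
      FCStep ((a, .app f ts) ::ₘ F, Δ) (↑(ts.map (fun t => (a, t))) + F, Δ)
  | sus {a : Atom} {π : NPerm} {X : Var} {F : FProb} {Δ : FCtx} :
      FCStep ((a, .susp π X) ::ₘ F, Δ) (F, insert (permAtom (permInv π) a, X) Δ)

/-- The algorithm FC succeeds on `F` with result `Γ`. -/
def FCReaches (F : FProb) (Γ : FCtx) : Prop :=
  Relation.ReflTransGen FCStep (F, ∅) (0, Γ)

/-- The algorithm FC fails on `F` (reaches a stuck state with remaining formulas). -/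
def FCFails (F : FProb) : Prop :=
  ∃ st : FProb × FCtx, Relation.ReflTransGen FCStep (F, ∅) st ∧ st.1 ≠ 0 ∧
    ∀ st', ¬ FCStep st st'

/-- The freshness problem `{a # Xσ | a#X ∈ Δ}` defining the instance `Δσ`. -/
def ctxSubstProb (Δ : FCtx) (σ : NSubst) : FProb :=
  Δ.val.map (fun c => (c.1, σ c.2))

/-! ### Terms-in-context and the subsumption order -/

/-- A term-in-context. -/
abbrev TIC := FCtx × NTerm

/-- `p ⪯ q`: the term-in-context `p` is more general than `q`.  (The condition
`p.1 σ ⊆ q.1` is expressed, equivalently by the properties of FC, as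
`q.1 ⊢ a # Xσ` for all `a # X ∈ p.1`.) -/
def TIC.Le (p q : TIC) : Prop :=
  ∃ σ : NSubst, Respects σ p.1 ∧
    (∀ c ∈ p.1, NFresh (↑q.1 : Set (Atom × Var)) c.1 (σ c.2)) ∧
    NAlpha (↑q.1 : Set (Atom × Var)) (substTerm σ p.2) q.2

/-- The strict part of `⪯`. -/
def TIC.Lt (p q : TIC) : Prop := TIC.Le p q ∧ ¬ TIC.Le q p

/-- Equi-generality `≃`. -/
def TIC.Equiv (p q : TIC) : Prop := TIC.Le p q ∧ TIC.Le q p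

/-- `r` is a generalization of `p₁` and `p₂`. -/
def IsGen (r p₁ p₂ : TIC) : Prop := TIC.Le r p₁ ∧ TIC.Le r p₂

/-! ### Atoms, variables, basedness -/

def permAtoms : NPerm → Finset Atom
  | [] => ∅
  | (a, b) :: π => insert a (insert b (permAtoms π))

def termAtoms : NTerm → Finset Atom
  | .app _ ts => (ts.attach.map (fun x => termAtoms x.1)).foldr (· ∪ ·) ∅
  | .atom a => {a}
  | .abs a t => insert a (termAtoms t)
  | .susp π _ => permAtoms π
decreasing_by
  all_goals (simp_wf; try omega)
  all_goals (have := List.sizeOf_lt_of_mem x.2; omega)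

def termVars : NTerm → Finset Var
  | .app _ ts => (ts.attach.map (fun x => termVars x.1)).foldr (· ∪ ·) ∅
  | .atom _ => ∅
  | .abs _ t => termVars t
  | .susp _ X => {X}
decreasing_by
  all_goals (simp_wf; try omega)
  all_goals (have := List.sizeOf_lt_of_mem x.2; omega)

/-- `FA(t)`: the atoms occurring freely in `t` (with `FA(π·X) = Atoms(π)`). -/
def termFA : NTerm → Finset Atom
  | .app _ ts => (ts.attach.map (fun x => termFA x.1)).foldr (· ∪ ·) ∅
  | .atom a => {a}
  | .abs a t => termFA t \ {a}
  | .susp π _ => permAtoms π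
decreasing_by
  all_goals (simp_wf; try omega)
  all_goals (have := List.sizeOf_lt_of_mem x.2; omega)

def ctxAtoms (Δ : FCtx) : Finset Atom := Δ.image Prod.fst
def ctxVars (Δ : FCtx) : Finset Var := Δ.image Prod.snd

def permBased (π : NPerm) (A : Finset Atom) : Prop := permAtoms π ⊆ A
def termBased (t : NTerm) (A : Finset Atom) : Prop := termAtoms t ⊆ A
def ctxBased (Δ : FCtx) (A : Finset Atom) : Prop := ctxAtoms Δ ⊆ A
def ticBased (p : TIC) (A : Finset Atom) : Prop := ctxBased p.1 A ∧ termBased p.2 A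

/-- The number of abstraction occurrences in a term. -/
def absCount : NTerm → ℕ
  | .app _ ts => (ts.attach.map (fun x => absCount x.1)).sum
  | .atom _ => 0
  | .abs _ t => absCount t + 1
  | .susp _ _ => 0
decreasing_by
  all_goals (simp_wf; try omega)
  all_goals (have := List.sizeOf_lt_of_mem x.2; omega)

/-! ### The nominal anti-unification algorithm 𝔑 -/

/-- Anti-unification triple `X : t ≜ s`. -/
abbrev AUT := Var × NTerm × NTerm

/-- A state of the algorithm 𝔑: the unsolved triples `P`, the store `S`, the
freshness context `Γ`, the substitution `σ`, and the set `V` of variables used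
so far (needed to express freshness of the generated variables). -/
structure NState where
  P : Multiset AUT
  S : Multiset AUT
  Γ : FCtx
  σ : NSubst
  V : Finset Var

/-- `σ{X ↦ u}`. -/
def updSubst (σ : NSubst) (X : Var) (u : NTerm) : NSubst :=
  substComp σ (fun Z => if Z = X then u else .susp [] Z)

/-- The head of a term (a function symbol together with its arity, an atom, the
abstraction operator, or a variable). -/
inductive NHead where
  | fn : Fn → ℕ → NHead
  | atom : Atom → NHead
  | abs : NHead
  | var : Var → NHead
deriving DecidableEq

def headOf : NTerm → NHead
  | .app f ts => .fn f ts.length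
  | .atom a => .atom a
  | .abs _ _ => .abs
  | .susp _ X => .var X

def IsSusp : NTerm → Prop
  | .susp _ _ => True
  | _ => False

def IsAbs : NTerm → Prop
  | .abs _ _ => True
  | _ => False

/-- The applicability condition of the rule Sol. -/
def SolCond (A : Finset Atom) (Δ : FCtx) (t s : NTerm) : Prop :=
  headOf t ≠ headOf s ∨ (IsSusp t ∧ IsSusp s) ∨
    (IsAbs t ∧ IsAbs s ∧
      ¬ ∃ c ∈ A, NFresh (↑Δ : Set (Atom × Var)) c t ∧ NFresh (↑Δ : Set (Atom × Var)) c s)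

open Classical in
/-- `{a # X | a ∈ A, Δ ⊢ a # t, Δ ⊢ a # s}`. -/
noncomputable def solSet (A : Finset Atom) (Δ : FCtx) (t s : NTerm) (X : Var) : FCtx :=
  (A.filter (fun a =>
    NFresh (↑Δ : Set (Atom × Var)) a t ∧ NFresh (↑Δ : Set (Atom × Var)) a s)).image
    (fun a => (a, X))

/-- `Γ{Y ↦ π·X}` on a freshness context. -/
def ctxRename (Γ : FCtx) (Y : Var) (π : NPerm) (X : Var) : FCtx :=
  Γ.image (fun c => if c.2 = Y then (permAtom (permInv π) c.1, X) else c)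

/-- One step of the algorithm 𝔑, with global parameters `A` and `Δ`. -/
inductive NStep (A : Finset Atom) (Δ : FCtx) : NState → NState → Prop
  | decApp {X : Var} {f : Fn} {ts ss : List NTerm} {P S : Multiset AUT} {Γ : FCtx}
      {σ : NSubst} {V : Finset Var} (Ys : List Var) :
      ts.length = ss.length → Ys.length = ts.length → Ys.Nodup →
      (∀ Y ∈ Ys, Y ∉ V) →
      NStep A Δ ⟨(X, .app f ts, .app f ss) ::ₘ P, S, Γ, σ, V⟩
        ⟨↑(List.zipWith (fun Y p => (Y, p)) Ys (List.zip ts ss)) + P, S, Γ,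
         updSubst σ X (.app f (Ys.map (fun Y => .susp [] Y))), V ∪ Ys.toFinset⟩
  | decAtom {X : Var} {a : Atom} {P S : Multiset AUT} {Γ : FCtx} {σ : NSubst}
      {V : Finset Var} :
      NStep A Δ ⟨(X, .atom a, .atom a) ::ₘ P, S, Γ, σ, V⟩
        ⟨P, S, Γ, updSubst σ X (.atom a), V⟩
  | abs {X : Var} {a b : Atom} {t s : NTerm} {P S : Multiset AUT} {Γ : FCtx}
      {σ : NSubst} {V : Finset Var} (Y : Var) (c : Atom) :
      Y ∉ V → c ∈ A →
      NFresh (↑Δ : Set (Atom × Var)) c (.abs a t) →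
      NFresh (↑Δ : Set (Atom × Var)) c (.abs b s) →
      NStep A Δ ⟨(X, .abs a t, .abs b s) ::ₘ P, S, Γ, σ, V⟩
        ⟨(Y, permTerm [(c, a)] t, permTerm [(c, b)] s) ::ₘ P, S, Γ,
         updSubst σ X (.abs c (.susp [] Y)), insert Y V⟩
  | sol {X : Var} {t s : NTerm} {P S : Multiset AUT} {Γ : FCtx} {σ : NSubst}
      {V : Finset Var} :
      SolCond A Δ t s →
      NStep A Δ ⟨(X, t, s) ::ₘ P, S, Γ, σ, V⟩
        ⟨P, (X, t, s) ::ₘ S, Γ ∪ solSet A Δ t s X, σ, V⟩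
  | mer {X Y : Var} {t₁ s₁ t₂ s₂ : NTerm} {P S : Multiset AUT} {Γ : FCtx}
      {σ : NSubst} {V : Finset Var} (π : NPerm) :
      X ≠ Y →
      permBased π (termAtoms t₁ ∪ termAtoms s₁ ∪ termAtoms t₂ ∪ termAtoms s₂) →
      NAlpha (↑Δ : Set (Atom × Var)) (permTerm π t₁) t₂ →
      NAlpha (↑Δ : Set (Atom × Var)) (permTerm π s₁) s₂ →
      NStep A Δ ⟨P, (X, t₁, s₁) ::ₘ (Y, t₂, s₂) ::ₘ S, Γ, σ, V⟩
        ⟨P, (X, t₁, s₁) ::ₘ S, ctxRename Γ Y π X, updSubst σ Y (.susp π X), V⟩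

/-- The initial state of 𝔑 on the triple `X : t ≜ s`. -/
def initNState (X : Var) (t s : NTerm) (Δ : FCtx) : NState :=
  ⟨{(X, t, s)}, 0, ∅, idSubst, insert X (termVars t ∪ termVars s ∪ ctxVars Δ)⟩

/-- An `A`-based least general generalization of `p₁` and `p₂`. -/
def IsABasedLgg (A : Finset Atom) (p p₁ p₂ : TIC) : Prop :=
  ticBased p A ∧ IsGen p p₁ p₂ ∧
    ¬ ∃ p' : TIC, ticBased p' A ∧ IsGen p' p₁ p₂ ∧ TIC.Lt p p'

/-! ### The equivariance algorithm 𝔈 -/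

/-- A set of equivariance equations `t ≈ s`. -/
abbrev EProb := Multiset (NTerm × NTerm)

def eqsAtoms (E : EProb) : Finset Atom :=
  (E.map (fun e => termAtoms e.1 ∪ termAtoms e.2)).sup

def eqsVars (E : EProb) : Finset Var :=
  (E.map (fun e => termVars e.1 ∪ termVars e.2)).sup

/-- All equations of `E` are equations between atoms. -/
def AtomEqs (E : EProb) : Prop := ∀ e ∈ E, ∃ a b : Atom, e = (NTerm.atom a, NTerm.atom b)

/-- One step of the equivariance algorithm 𝔈 (with fixed freshness context `Δ`) on
states `(E; A; π)`.  The first-phase rules require `π = Id`; the second-phase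
rules require that only equations between atoms are left. -/
inductive EStep (Δ : FCtx) :
    EProb × Finset Atom × NPerm → EProb × Finset Atom × NPerm → Prop
  | dec {f : Fn} {ts ss : List NTerm} {E : EProb} {A : Finset Atom} :
      ts.length = ss.length →
      EStep Δ ((.app f ts, .app f ss) ::ₘ E, A, []) (↑(List.zip ts ss) + E, A, [])
  | alp {a b : Atom} {t s : NTerm} {E : EProb} {A : Finset Atom} (c : Atom) :
      c ∉ A → c ∉ eqsAtoms ((.abs a t, .abs b s) ::ₘ E) → c ∉ ctxAtoms Δ →
      EStep Δ ((.abs a t, .abs b s) ::ₘ E, A, [])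
        ((permTerm [(c, a)] t, permTerm [(c, b)] s) ::ₘ E, A, [])
  | sus {π₁ π₂ : NPerm} {X : Var} {E : EProb} {A : Finset Atom} :
      EStep Δ ((.susp π₁ X, .susp π₂ X) ::ₘ E, A, [])
        (↑((A.filter (fun a => (a, X) ∉ Δ)).toList.map
            (fun a => (NTerm.atom (permAtom π₁ a), NTerm.atom (permAtom π₂ a)))) + E,
         A, [])
  | rem {a b : Atom} {E : EProb} {A : Finset Atom} {π : NPerm} :
      AtomEqs ((.atom a, .atom b) ::ₘ E) → permAtom π a = b →
      EStep Δ ((.atom a, .atom b) ::ₘ E, A, π) (E, A.erase b, π)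
  | sol {a b : Atom} {E : EProb} {A : Finset Atom} {π : NPerm} :
      AtomEqs ((.atom a, .atom b) ::ₘ E) →
      permAtom π a ∈ A → b ∈ A → permAtom π a ≠ b →
      EStep Δ ((.atom a, .atom b) ::ₘ E, A, π) (E, A.erase b, (permAtom π a, b) :: π)

/-! ### Basic equations and induction -/

theorem NTerm.induct {P : NTerm → Prop} (happ : ∀ f ts, (∀ t ∈ ts, P t) → P (.app f ts))
    (hatom : ∀ a, P (.atom a)) (habs : ∀ a t, P t → P (.abs a t))
    (hsusp : ∀ π X, P (.susp π X)) : ∀ t, P t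
  | .app f ts => happ f ts (fun t _ => NTerm.induct happ hatom habs hsusp t)
  | .atom a => hatom a
  | .abs a t => habs a t (NTerm.induct happ hatom habs hsusp t)
  | .susp π X => hsusp π X

@[simp] theorem permTerm_app (π : NPerm) (f : Fn) (ts : List NTerm) :
    permTerm π (.app f ts) = .app f (ts.map (permTerm π)) := by
  rw [permTerm]; simp

@[simp] theorem permTerm_atom (π : NPerm) (a : Atom) :
    permTerm π (.atom a) = .atom (permAtom π a) := by rw [permTerm]

@[simp] theorem permTerm_abs (π : NPerm) (a : Atom) (t : NTerm) :
    permTerm π (.abs a t) = .abs (permAtom π a) (permTerm π t) := by rw [permTerm]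

@[simp] theorem permTerm_susp (π ρ : NPerm) (X : Var) :
    permTerm π (.susp ρ X) = .susp (π ++ ρ) X := by rw [permTerm]

@[simp] theorem substTerm_app (σ : NSubst) (f : Fn) (ts : List NTerm) :
    substTerm σ (.app f ts) = .app f (ts.map (substTerm σ)) := by
  rw [substTerm]; simp

@[simp] theorem substTerm_atom (σ : NSubst) (a : Atom) :
    substTerm σ (.atom a) = .atom a := by rw [substTerm]

@[simp] theorem substTerm_abs (σ : NSubst) (a : Atom) (t : NTerm) :
    substTerm σ (.abs a t) = .abs a (substTerm σ t) := by rw [substTerm]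

@[simp] theorem substTerm_susp (σ : NSubst) (π : NPerm) (X : Var) :
    substTerm σ (.susp π X) = permTerm π (σ X) := by rw [substTerm]

theorem mem_foldr_union {α β : Type*} [DecidableEq β] (g : α → Finset β) (l : List α) (b : β) :
    b ∈ (l.map g).foldr (· ∪ ·) ∅ ↔ ∃ x ∈ l, b ∈ g x := by
  induction l with
  | nil => simp
  | cons x l ih => simp [ih]

theorem mem_FAnoSusp_app {f : Fn} {ts : List NTerm} {a : Atom} :
    a ∈ FAnoSusp (.app f ts) ↔ ∃ t ∈ ts, a ∈ FAnoSusp t := by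
  rw [FAnoSusp, mem_foldr_union]; simp

theorem mem_termAtoms_app {f : Fn} {ts : List NTerm} {a : Atom} :
    a ∈ termAtoms (.app f ts) ↔ ∃ t ∈ ts, a ∈ termAtoms t := by
  rw [termAtoms, mem_foldr_union]; simp

theorem mem_termVars_app {f : Fn} {ts : List NTerm} {X : Var} :
    X ∈ termVars (.app f ts) ↔ ∃ t ∈ ts, X ∈ termVars t := by
  rw [termVars, mem_foldr_union]; simp

@[simp] theorem termVars_abs (a : Atom) (t : NTerm) : termVars (.abs a t) = termVars t := by
  rw [termVars]

@[simp] theorem termVars_susp (π : NPerm) (X : Var) : termVars (.susp π X) = {X} := by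
  rw [termVars]

theorem termBased_app {f : Fn} {ts : List NTerm} {A : Finset Atom} :
    termBased (.app f ts) A ↔ ∀ t ∈ ts, termBased t A := by
  simp only [termBased, Finset.subset_iff, mem_termAtoms_app]
  grind

theorem termBased_atom {a : Atom} {A : Finset Atom} : termBased (.atom a) A ↔ a ∈ A := by
  simp [termBased, termAtoms]

theorem termBased_abs {a : Atom} {t : NTerm} {A : Finset Atom} :
    termBased (.abs a t) A ↔ a ∈ A ∧ termBased t A := by
  simp [termBased, termAtoms, Finset.insert_subset_iff]

theorem termBased_susp {π : NPerm} {X : Var} {A : Finset Atom} :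
    termBased (.susp π X) A ↔ permBased π A := by
  simp [termBased, termAtoms, permBased]

/-! ### Permutations -/

theorem swapAtom_swapAtom (a b c : Atom) : swapAtom a b (swapAtom a b c) = c := by
  unfold swapAtom; grind

theorem permAtom_append (π ρ : NPerm) (a : Atom) :
    permAtom (π ++ ρ) a = permAtom π (permAtom ρ a) := by
  induction π with
  | nil => rfl
  | cons p π ih => obtain ⟨x, y⟩ := p; simp [permAtom, ih]

@[simp] theorem permAtom_nil (a : Atom) : permAtom [] a = a := rfl

@[simp] theorem permAtom_cons (a b c : Atom) (π : NPerm) :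
    permAtom ((a, b) :: π) c = swapAtom a b (permAtom π c) := rfl

@[simp] theorem permAtom_permInv (π : NPerm) (a : Atom) :
    permAtom π (permAtom (permInv π) a) = a := by
  induction π generalizing a with
  | nil => rfl
  | cons p π ih =>
    obtain ⟨x, y⟩ := p
    have h := ih (swapAtom x y a)
    simp only [permInv] at h
    simp [permInv, permAtom_append, h, swapAtom_swapAtom]

@[simp] theorem permInv_permAtom (π : NPerm) (a : Atom) :
    permAtom (permInv π) (permAtom π a) = a := by
  have h := permAtom_permInv (permInv π) a
  rwa [permInv, permInv, List.reverse_reverse] at h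

theorem permAtom_injective (π : NPerm) : Function.Injective (permAtom π) :=
  Function.LeftInverse.injective (permInv_permAtom π)

theorem permTerm_append (π ρ : NPerm) (t : NTerm) :
    permTerm (π ++ ρ) t = permTerm π (permTerm ρ t) := by
  induction t using NTerm.induct with
  | happ f ts ih => simpa using ih
  | hatom a => simp [permAtom_append]
  | habs a t ih => simp [permAtom_append, ih]
  | hsusp ρ X => simp

theorem permTerm_nil (t : NTerm) : permTerm [] t = t := by
  induction t using NTerm.induct with
  | happ f ts ih =>
    have : ts.map (permTerm []) = ts.map id := List.map_congr_left ih
    simp [this]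
  | hatom a => simp
  | habs a t ih => simp [ih]
  | hsusp ρ X => simp

theorem permBased_cons {a b : Atom} {π : NPerm} {A : Finset Atom} :
    permBased ((a, b) :: π) A ↔ a ∈ A ∧ b ∈ A ∧ permBased π A := by
  simp [permBased, permAtoms, Finset.insert_subset_iff]

theorem permBased_nil (A : Finset Atom) : permBased [] A := by
  simp [permBased, permAtoms]

theorem permBased.append {π ρ : NPerm} {A : Finset Atom} (hπ : permBased π A)
    (hρ : permBased ρ A) : permBased (π ++ ρ) A := by
  induction π with
  | nil => exact hρ
  | cons p π ih =>
    obtain ⟨x, y⟩ := p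
    rw [List.cons_append, permBased_cons] at *
    exact ⟨hπ.1, hπ.2.1, ih hπ.2.2⟩

theorem permBased.inv {π : NPerm} {A : Finset Atom} (hπ : permBased π A) :
    permBased (permInv π) A := by
  induction π with
  | nil => exact hπ
  | cons p π ih =>
    obtain ⟨x, y⟩ := p
    rw [permBased_cons] at hπ
    have := (ih hπ.2.2).append (permBased_cons.2 ⟨hπ.1, hπ.2.1, permBased_nil A⟩)
    simpa [permInv] using this

theorem permBased.permAtom_of_notMem {π : NPerm} {A : Finset Atom} (hπ : permBased π A)
    {a : Atom} (ha : a ∉ A) : permAtom π a = a := by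
  induction π with
  | nil => rfl
  | cons p π ih =>
    obtain ⟨x, y⟩ := p
    rw [permBased_cons] at hπ
    rw [permAtom_cons, ih hπ.2.2, swapAtom]
    grind

theorem permBased.permAtom_mem {π : NPerm} {A : Finset Atom} (hπ : permBased π A)
    {a : Atom} : permAtom π a ∈ A ↔ a ∈ A := by
  constructor
  · intro h
    by_contra ha
    exact ha (hπ.permAtom_of_notMem ha ▸ h)
  · intro h
    by_contra ha
    have h2 := hπ.permAtom_of_notMem ha
    exact ha (by rwa [permAtom_injective π h2])

/-! ### Freshness -/

section Freshness

variable {Δ : Set (Atom × Var)}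

@[simp] theorem nFresh_atom {a b : Atom} : NFresh Δ a (.atom b) ↔ a ≠ b :=
  ⟨fun h => by cases h; assumption, .atom⟩

@[simp] theorem nFresh_susp {a : Atom} {π : NPerm} {X : Var} :
    NFresh Δ a (.susp π X) ↔ (permAtom (permInv π) a, X) ∈ Δ :=
  ⟨fun h => by cases h; assumption, .susp⟩

@[simp] theorem nFresh_app {a : Atom} {f : Fn} {ts : List NTerm} :
    NFresh Δ a (.app f ts) ↔ ∀ t ∈ ts, NFresh Δ a t :=
  ⟨fun h => by cases h; assumption, .app⟩

@[simp] theorem nFresh_abs {a b : Atom} {t : NTerm} :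
    NFresh Δ a (.abs b t) ↔ a = b ∨ NFresh Δ a t := by
  constructor
  · intro h
    cases h with
    | abs1 => exact .inl rfl
    | abs2 _ h => exact .inr h
  · intro h
    by_cases hab : a = b
    · subst hab; exact .abs1
    · exact .abs2 hab (h.resolve_left hab)

theorem nFresh_permTerm {a : Atom} {π : NPerm} {t : NTerm} :
    NFresh Δ (permAtom π a) (permTerm π t) ↔ NFresh Δ a t := by
  induction t using NTerm.induct with
  | happ f ts ih => simpa using forall₂_congr ih
  | hatom b => simp [(permAtom_injective π).eq_iff]
  | habs b t ih => simp [(permAtom_injective π).eq_iff, ih]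
  | hsusp ρ X =>
    have : permAtom (permInv (π ++ ρ)) (permAtom π a) = permAtom (permInv ρ) a := by
      apply permAtom_injective (π ++ ρ)
      simp [permAtom_append]
    simp [this]

theorem nFresh_permTerm' {a : Atom} {π : NPerm} {t : NTerm} :
    NFresh Δ a (permTerm π t) ↔ NFresh Δ (permAtom (permInv π) a) t := by
  rw [← nFresh_permTerm (π := π) (t := t), permAtom_permInv]

/-- Freshness in a renamed abstraction body. -/
theorem nFresh_swap_body {a c d : Atom} {t : NTerm} (hd : d ≠ c) (hdt : NFresh Δ d (.abs a t))
    (hct : NFresh Δ c (.abs a t)) : NFresh Δ d (permTerm [(c, a)] t) := by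
  rw [nFresh_permTerm']
  rw [nFresh_abs] at *
  have : permAtom (permInv [(c, a)]) d = if d = a then c else d := by
    simp only [permInv, List.reverse_singleton, permAtom_cons, permAtom_nil, swapAtom, hd, if_false]
    grind
  rw [this]
  split_ifs with h
  · subst h; exact hct.resolve_left (Ne.symm hd)
  · exact hdt.resolve_left h

theorem NFresh.notMem_FAnoSusp {a : Atom} {t : NTerm} (h : NFresh Δ a t) : a ∉ FAnoSusp t := by
  induction t using NTerm.induct with
  | happ f ts ih => rw [mem_FAnoSusp_app]; grind [nFresh_app]
  | hatom b => simpa [FAnoSusp] using h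
  | habs b t ih => simp [FAnoSusp]; grind [nFresh_abs]
  | hsusp ρ X => simp [FAnoSusp]

end Freshness

/-! ### A nameless model of α-equivalence -/

/-- Nameless terms; a suspended variable carries the values of its non-fresh atoms. -/
inductive DTerm where
  | app : Fn → List DTerm → DTerm
  | atom : ℕ → DTerm
  | abs : DTerm → DTerm
  | susp : (Atom → Option ℕ) → Var → DTerm

/-- Extend a valuation of atoms by a new innermost binder for `a`. -/
def bindVal (f : Atom → ℕ) (a : Atom) : Atom → ℕ := fun x => if x = a then 0 else f x + 1

open Classical in
/-- The nameless interpretation of a term under a valuation of its atoms. -/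
noncomputable def nameless (Δ : Set (Atom × Var)) : (Atom → ℕ) → NTerm → DTerm
  | f, .app g ts => .app g (ts.attach.map (fun x => nameless Δ f x.1))
  | f, .atom a => .atom (f a)
  | f, .abs a t => .abs (nameless Δ (bindVal f a) t)
  | f, .susp π X => .susp (fun a => if (a, X) ∈ Δ then none else some (f (permAtom π a))) X
termination_by _ t => sizeOf t
decreasing_by
  all_goals (simp_wf; try omega)
  all_goals (have := List.sizeOf_lt_of_mem x.2; omega)

section Nameless

variable {Δ : Set (Atom × Var)}

@[simp] theorem nameless_app (f : Atom → ℕ) (g : Fn) (ts : List NTerm) :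
    nameless Δ f (.app g ts) = .app g (ts.map (nameless Δ f)) := by
  rw [nameless]; simp

@[simp] theorem nameless_atom (f : Atom → ℕ) (a : Atom) :
    nameless Δ f (.atom a) = .atom (f a) := by rw [nameless]

@[simp] theorem nameless_abs (f : Atom → ℕ) (a : Atom) (t : NTerm) :
    nameless Δ f (.abs a t) = .abs (nameless Δ (bindVal f a) t) := by rw [nameless]

theorem nameless_susp_eq_iff {f g : Atom → ℕ} {π ρ : NPerm} {X Y : Var} :
    nameless Δ f (.susp π X) = nameless Δ g (.susp ρ Y) ↔
      X = Y ∧ ∀ a, (a, X) ∉ Δ → f (permAtom π a) = g (permAtom ρ a) := by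
  rw [nameless, nameless, DTerm.susp.injEq, and_comm]
  refine and_congr_right ?_
  rintro rfl
  rw [funext_iff]
  refine forall_congr' fun a => ?_
  by_cases h : (a, X) ∈ Δ <;> simp [h]

theorem nameless_permTerm (f : Atom → ℕ) (π : NPerm) (t : NTerm) :
    nameless Δ f (permTerm π t) = nameless Δ (f ∘ permAtom π) t := by
  induction t using NTerm.induct generalizing f with
  | happ g ts ih => simpa using fun t ht => ih t ht f
  | hatom a => simp
  | habs a t ih =>
    have : bindVal f (permAtom π a) ∘ permAtom π = bindVal (f ∘ permAtom π) a := by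
      funext x
      simp [bindVal, (permAtom_injective π).eq_iff]
    simp [ih, this]
  | hsusp ρ X =>
    rw [permTerm_susp, nameless_susp_eq_iff]
    simp [permAtom_append]

theorem nameless_congr_iff {f g : Atom → ℕ} {t : NTerm} :
    nameless Δ f t = nameless Δ g t ↔ ∀ a, ¬ NFresh Δ a t → f a = g a := by
  induction t using NTerm.induct generalizing f g with
  | happ h ts ih =>
    simp only [nameless_app, DTerm.app.injEq, true_and, List.map_inj_left, nFresh_app]
    constructor
    · intro H a ha
      push Not at ha
      obtain ⟨t, ht, hat⟩ := ha
      exact (ih t ht).1 (H t ht) a hat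
    · intro H t ht
      exact (ih t ht).2 fun a ha => H a fun h => ha (h t ht)
  | hatom a => simp
  | habs b t ih =>
    simp only [nameless_abs, DTerm.abs.injEq, ih, nFresh_abs, bindVal]
    grind
  | hsusp π X =>
    rw [nameless_susp_eq_iff]
    simp only [true_and, nFresh_susp]
    constructor
    · intro H a ha
      simpa using H _ ha
    · intro H a ha
      exact H _ (by simpa using ha)

theorem nameless_comp {f g : Atom → ℕ} {t s : NTerm} (h : ℕ → ℕ)
    (H : nameless Δ f t = nameless Δ g s) :
    nameless Δ (h ∘ f) t = nameless Δ (h ∘ g) s := by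
  induction t using NTerm.induct generalizing f g s h with
  | happ k ts ih =>
    cases s with
    | app k' ss =>
      simp only [nameless_app, DTerm.app.injEq] at H ⊢
      refine ⟨H.1, ?_⟩
      have hl : ts.length = ss.length := by simpa using congrArg List.length H.2
      refine List.ext_getElem (by simpa using hl) fun i h₁ h₂ => ?_
      simp only [List.length_map] at h₁ h₂
      have := List.getElem_of_eq H.2 (i := i) (by simpa using h₁)
      simp only [List.getElem_map] at this ⊢
      exact ih _ (List.getElem_mem h₁) h this
    | atom _ | abs _ _ => simp at H
    | susp _ _ => rw [nameless_app, nameless] at H; cases H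
  | hatom a =>
    cases s with
    | atom _ => simp at H; simp [H]
    | app _ _ | abs _ _ => simp at H
    | susp _ _ => rw [nameless_atom, nameless] at H; cases H
  | habs a t ih =>
    cases s with
    | abs b s =>
      simp only [nameless_abs, DTerm.abs.injEq] at H ⊢
      have key : ∀ (f : Atom → ℕ) (a : Atom),
          bindVal (h ∘ f) a = (fun n => Nat.casesOn n 0 fun m => h m + 1) ∘ bindVal f a := by
        intro f a
        funext x
        by_cases hx : x = a <;> simp [bindVal, hx]
      rw [key, key]
      exact ih _ H
    | app _ _ | atom _ => simp at H
    | susp _ _ => rw [nameless_abs, nameless] at H; cases H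
  | hsusp π X =>
    cases s with
    | susp ρ Y =>
      rw [nameless_susp_eq_iff] at H ⊢
      exact ⟨H.1, fun a ha => congrArg h (H.2 a ha)⟩
    | app _ _ => rw [nameless_app, nameless] at H; cases H
    | atom _ => rw [nameless_atom, nameless] at H; cases H
    | abs _ _ => rw [nameless_abs, nameless] at H; cases H

/-- Equal interpretations attain the same values on non-fresh atoms. -/
theorem exists_not_nFresh_of_nameless_eq {f g : Atom → ℕ} {t s : NTerm}
    (H : nameless Δ f t = nameless Δ g s) {a : Atom} (ha : ¬ NFresh Δ a s) :
    ∃ b, ¬ NFresh Δ b t ∧ f b = g a := by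
  induction t using NTerm.induct generalizing f g s with
  | happ k ts ih =>
    cases s with
    | app k' ss =>
      simp only [nameless_app, DTerm.app.injEq] at H
      have hl : ts.length = ss.length := by simpa using congrArg List.length H.2
      rw [nFresh_app] at ha
      push Not at ha
      obtain ⟨s, hs, has⟩ := ha
      obtain ⟨i, hi, rfl⟩ := List.getElem_of_mem hs
      have := List.getElem_of_eq H.2 (i := i) (by simpa [hl] using hi)
      simp only [List.getElem_map] at this
      obtain ⟨b, hb, hbe⟩ := ih _ (List.getElem_mem (hl ▸ hi)) this has
      exact ⟨b, fun h => hb (nFresh_app.1 h _ (List.getElem_mem _)), hbe⟩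
    | atom _ | abs _ _ => simp at H
    | susp _ _ => rw [nameless_app, nameless] at H; cases H
  | hatom b =>
    cases s with
    | atom _ => simp at H ha; subst ha; exact ⟨b, by simp, H⟩
    | app _ _ | abs _ _ => simp at H
    | susp _ _ => rw [nameless_atom, nameless] at H; cases H
  | habs c t ih =>
    cases s with
    | abs b s =>
      simp only [nameless_abs, DTerm.abs.injEq, nFresh_abs, not_or] at H ha
      obtain ⟨x, hx, hxe⟩ := ih H ha.2
      simp only [bindVal, ha.1, if_false] at hxe
      have hxc : x ≠ c := by rintro rfl; simp at hxe
      exact ⟨x, by simp [hx, hxc], by simpa [hxc] using hxe⟩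
    | app _ _ | atom _ => simp at H
    | susp _ _ => rw [nameless_abs, nameless] at H; cases H
  | hsusp π X =>
    cases s with
    | susp ρ Y =>
      rw [nameless_susp_eq_iff] at H
      obtain ⟨rfl, H⟩ := H
      rw [nFresh_susp] at ha
      exact ⟨permAtom π (permAtom (permInv ρ) a), by simpa using ha, by simpa using H _ ha⟩
    | app _ _ => rw [nameless_app, nameless] at H; cases H
    | atom _ => rw [nameless_atom, nameless] at H; cases H
    | abs _ _ => rw [nameless_abs, nameless] at H; cases H

theorem nAlpha_app_iff {f g : Fn} {ts ss : List NTerm} :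
    NAlpha Δ (.app f ts) (.app g ss) ↔ f = g ∧ ∃ h : ts.length = ss.length,
      ∀ i (hi : i < ts.length), NAlpha Δ ts[i] ss[i] := by
  constructor
  · intro H
    cases H with
    | app hl H =>
      refine ⟨rfl, hl, fun i hi => H (ts[i], ss[i]) ?_⟩
      rw [List.mem_iff_getElem]
      exact ⟨i, by simp [← hl, hi], by simp⟩
  · rintro ⟨rfl, hl, H⟩
    refine .app hl fun p hp => ?_
    obtain ⟨i, hi, rfl⟩ := List.getElem_of_mem hp
    rw [List.getElem_zip]
    exact H i _

theorem NAlpha.nameless_eq {t s : NTerm} (H : NAlpha Δ t s) (f : Atom → ℕ) :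
    nameless Δ f t = nameless Δ f s := by
  induction H generalizing f with
  | atom a => rfl
  | abs1 _ ih => simp [ih]
  | @abs2 a b t t' hab _ hf ih =>
    rw [nameless_abs, nameless_abs, ih, nameless_permTerm, DTerm.abs.injEq, nameless_congr_iff]
    intro x hx
    have : x ≠ a := by rintro rfl; exact hx hf
    simp only [Function.comp, permAtom_cons, permAtom_nil, bindVal, swapAtom]
    grind
  | susp h =>
    rw [nameless_susp_eq_iff]
    refine ⟨rfl, fun a ha => ?_⟩
    by_contra hne
    exact ha (h a fun h => hne (h ▸ rfl))
  | @app g ts ss hl _ ih =>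
    simp only [nameless_app, DTerm.app.injEq, true_and]
    refine List.ext_getElem (by simpa using hl) fun i h₁ h₂ => ?_
    simp only [List.length_map] at h₁ h₂
    simp only [List.getElem_map]
    refine ih (ts[i], ss[i]) ?_ f
    rw [List.mem_iff_getElem]
    exact ⟨i, by simp [h₁, h₂], by simp⟩

theorem nAlpha_of_nameless_eq {f : Atom → ℕ} (hf : Function.Injective f) {t s : NTerm}
    (H : nameless Δ f t = nameless Δ f s) : NAlpha Δ t s := by
  induction t using NTerm.induct generalizing f s with
  | happ k ts ih =>
    cases s with
    | app k' ss =>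
      simp only [nameless_app, DTerm.app.injEq] at H
      have hl : ts.length = ss.length := by simpa using congrArg List.length H.2
      refine nAlpha_app_iff.2 ⟨H.1, hl, fun i hi => ?_⟩
      have := List.getElem_of_eq H.2 (i := i) (by simpa using hi)
      simp only [List.getElem_map] at this
      exact ih _ (List.getElem_mem hi) hf this
    | atom _ | abs _ _ => simp at H
    | susp _ _ => rw [nameless_app, nameless] at H; cases H
  | hatom a =>
    cases s with
    | atom _ => simp [hf.eq_iff] at H; subst H; exact .atom _
    | app _ _ | abs _ _ => simp at H
    | susp _ _ => rw [nameless_atom, nameless] at H; cases H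
  | habs a t ih =>
    cases s with
    | abs b s =>
      simp only [nameless_abs, DTerm.abs.injEq] at H
      have hinj : Function.Injective (bindVal f a) := by
        intro x y
        have := @hf x y
        simp only [bindVal]
        grind
      by_cases hab : a = b
      · subst hab; exact .abs1 (ih hinj H)
      · have has : NFresh Δ a s := by
          by_contra hs
          obtain ⟨x, -, hx⟩ := exists_not_nFresh_of_nameless_eq H hs
          have := @hf x a
          simp only [bindVal] at hx
          grind
        refine .abs2 hab (ih hinj (H.trans ?_)) has
        rw [nameless_permTerm, nameless_congr_iff]
        intro x hx
        have : x ≠ a := by rintro rfl; exact hx has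
        simp only [Function.comp, permAtom_cons, permAtom_nil, bindVal, swapAtom]
        grind
    | app _ _ | atom _ => simp at H
    | susp _ _ => rw [nameless_abs, nameless] at H; cases H
  | hsusp π X =>
    cases s with
    | susp ρ Y =>
      rw [nameless_susp_eq_iff] at H
      obtain ⟨rfl, H⟩ := H
      refine .susp fun a ha => ?_
      by_contra hn
      exact ha (hf (H a hn))
    | app _ _ => rw [nameless_app, nameless] at H; cases H
    | atom _ => rw [nameless_atom, nameless] at H; cases H
    | abs _ _ => rw [nameless_abs, nameless] at H; cases H

theorem nAlpha_iff {t s : NTerm} : NAlpha Δ t s ↔ nameless Δ id t = nameless Δ id s :=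
  ⟨fun h => h.nameless_eq id, nAlpha_of_nameless_eq Function.injective_id⟩

theorem NAlpha.refl (t : NTerm) : NAlpha Δ t t := nAlpha_iff.2 rfl

theorem NAlpha.symm {t s : NTerm} (h : NAlpha Δ t s) : NAlpha Δ s t :=
  nAlpha_iff.2 (nAlpha_iff.1 h).symm

theorem NAlpha.trans {t s u : NTerm} (h : NAlpha Δ t s) (h' : NAlpha Δ s u) : NAlpha Δ t u :=
  nAlpha_iff.2 ((nAlpha_iff.1 h).trans (nAlpha_iff.1 h'))

theorem NAlpha.permTerm {t s : NTerm} (h : NAlpha Δ t s) (π : NPerm) :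
    NAlpha Δ (permTerm π t) (permTerm π s) := by
  rw [nAlpha_iff, nameless_permTerm, nameless_permTerm]
  exact h.nameless_eq _

theorem NAlpha.nFresh {t s : NTerm} (h : NAlpha Δ t s) {a : Atom} (ha : NFresh Δ a t) :
    NFresh Δ a s := by
  by_contra hs
  obtain ⟨b, hb, rfl⟩ := exists_not_nFresh_of_nameless_eq (nAlpha_iff.1 h) hs
  exact hb ha

theorem nAlpha_permTerm_iff {π ρ : NPerm} {t : NTerm} :
    NAlpha Δ (permTerm π t) (permTerm ρ t) ↔
      ∀ a, ¬ NFresh Δ a t → permAtom π a = permAtom ρ a := by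
  rw [nAlpha_iff, nameless_permTerm, nameless_permTerm, nameless_congr_iff]
  rfl

theorem nAlpha_permInv_permTerm (π : NPerm) (t : NTerm) :
    NAlpha Δ (permTerm (permInv π) (permTerm π t)) t := by
  have : NAlpha Δ (permTerm (permInv π ++ π) t) (permTerm [] t) :=
    nAlpha_permTerm_iff.2 fun a _ => by simp [permAtom_append]
  rwa [permTerm_append, permTerm_nil] at this

theorem nAlpha_swap_self (a : Atom) (t : NTerm) : NAlpha Δ (permTerm [(a, a)] t) t := by
  have : NAlpha Δ (permTerm [(a, a)] t) (permTerm [] t) :=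
    nAlpha_permTerm_iff.2 fun x _ => by simp only [permAtom_cons, permAtom_nil, swapAtom]; grind
  rwa [permTerm_nil] at this

/-- Opening two α-equivalent abstractions with an atom fresh for both. -/
theorem NAlpha.open_abs {a b c : Atom} {t s : NTerm} (h : NAlpha Δ (.abs a t) (.abs b s))
    (ht : NFresh Δ c (.abs a t)) :
    NAlpha Δ (_root_.permTerm [(c, a)] t) (_root_.permTerm [(c, b)] s) := by
  have hs := h.nFresh ht
  have key : ∀ (a : Atom) (t : NTerm), NFresh Δ c (.abs a t) →
      nameless Δ id (_root_.permTerm [(c, a)] t) =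
        nameless Δ ((fun n => if n = 0 then c else n - 1) ∘ bindVal id a) t := by
    intro a t h
    rw [nameless_permTerm, nameless_congr_iff]
    intro x hx
    have : x = c → c = a := by
      rintro rfl
      exact (nFresh_abs.1 h).resolve_right hx
    simp only [Function.comp, bindVal, permAtom_cons, permAtom_nil, swapAtom, id]
    grind
  rw [nAlpha_iff, key a t ht, key b s hs]
  have := h.nameless_eq id
  simp only [nameless_abs, DTerm.abs.injEq] at this
  exact nameless_comp _ this

/-- Renaming the bound atom of an abstraction. -/
theorem NAlpha.abs_of_swap {a c : Atom} {t u : NTerm} (h : NAlpha Δ u (_root_.permTerm [(c, a)] t))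
    (hc : NFresh Δ c (.abs a t)) : NAlpha Δ (.abs c u) (.abs a t) := by
  by_cases hca : c = a
  · subst hca
    exact .abs1 (h.trans (nAlpha_swap_self c t))
  · exact .abs2 hca h ((nFresh_abs.1 hc).resolve_left hca)

end Nameless

/-! ### Variables -/

theorem termVars_permTerm (π : NPerm) (t : NTerm) : termVars (permTerm π t) = termVars t := by
  induction t using NTerm.induct with
  | happ f ts ih =>
    ext X
    rw [permTerm_app, mem_termVars_app, mem_termVars_app]
    grind
  | hatom a => simp [termVars]
  | habs a t ih => simp [ih]
  | hsusp ρ X => simp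

theorem NAlpha.termVars_eq {Δ : Set (Atom × Var)} {t s : NTerm} (h : NAlpha Δ t s) :
    termVars t = termVars s := by
  induction h with
  | atom a => rfl
  | abs1 _ ih => simpa using ih
  | abs2 _ _ _ ih => simpa [termVars_permTerm] using ih
  | susp _ => simp
  | @app f ts ss hl _ ih =>
    ext X
    simp only [mem_termVars_app, List.mem_iff_getElem]
    have key : ∀ i (h₁ : i < ts.length) (h₂ : i < ss.length),
        termVars ts[i] = termVars ss[i] := by
      intro i h₁ h₂
      refine ih (ts[i], ss[i]) ?_
      rw [List.mem_iff_getElem]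
      exact ⟨i, by simp [h₁, h₂], by simp⟩
    constructor
    · rintro ⟨t, ⟨i, hi, rfl⟩, hX⟩
      exact ⟨_, ⟨i, hl ▸ hi, rfl⟩, key i hi (hl ▸ hi) ▸ hX⟩
    · rintro ⟨t, ⟨i, hi, rfl⟩, hX⟩
      exact ⟨_, ⟨i, hl ▸ hi, rfl⟩, key i (hl ▸ hi) hi ▸ hX⟩

theorem NFresh.restrict {Δ Δ' : Set (Atom × Var)} {V : Finset Var}
    (hΔ : ∀ c ∈ Δ, c.2 ∈ V → c ∈ Δ') {a : Atom} {t : NTerm} (h : NFresh Δ a t)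
    (hV : termVars t ⊆ V) : NFresh Δ' a t := by
  induction h with
  | atom h => exact .atom h
  | susp h => exact .susp (hΔ _ h (by simpa using hV))
  | app _ ih => exact .app fun t ht => ih t ht fun X hX => hV (mem_termVars_app.2 ⟨t, ht, hX⟩)
  | abs1 => exact .abs1
  | abs2 h _ ih => exact .abs2 h (ih (by simpa using hV))

theorem NAlpha.restrict {Δ Δ' : Set (Atom × Var)} {V : Finset Var}
    (hΔ : ∀ c ∈ Δ, c.2 ∈ V → c ∈ Δ') {t s : NTerm} (h : NAlpha Δ t s)
    (hV : termVars s ⊆ V) : NAlpha Δ' t s := by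
  induction h with
  | atom a => exact .atom a
  | abs1 _ ih => exact .abs1 (ih (by simpa using hV))
  | abs2 hab _ hf ih =>
    rw [termVars_abs] at hV
    exact .abs2 hab (ih (by simpa [termVars_permTerm] using hV)) (hf.restrict hΔ hV)
  | susp h => exact .susp fun a ha => hΔ _ (h a ha) (by simpa using hV)
  | app hl _ ih =>
    exact .app hl fun p hp => ih p hp fun X hX =>
      hV (mem_termVars_app.2 ⟨p.2, (List.of_mem_zip hp).2, hX⟩)

theorem termVars_subset_substTerm {τ : NSubst} {r : NTerm} {X : Var} (hX : X ∈ termVars r) :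
    termVars (τ X) ⊆ termVars (substTerm τ r) := by
  induction r using NTerm.induct with
  | happ f ts ih =>
    obtain ⟨t, ht, hXt⟩ := mem_termVars_app.1 hX
    intro Y hY
    rw [substTerm_app, mem_termVars_app]
    exact ⟨_, List.mem_map_of_mem ht, ih t ht hXt hY⟩
  | hatom a => simp [termVars] at hX
  | habs a t ih => simpa using ih (by simpa using hX)
  | hsusp π Y =>
    obtain rfl : X = Y := by simpa using hX
    simp [termVars_permTerm]

theorem substTerm_congr {τ τ' : NSubst} {r : NTerm} (h : ∀ X ∈ termVars r, τ X = τ' X) :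
    substTerm τ r = substTerm τ' r := by
  induction r using NTerm.induct with
  | happ f ts ih =>
    simp only [substTerm_app, NTerm.app.injEq, true_and, List.map_inj_left]
    exact fun t ht => ih t ht fun X hX => h X (mem_termVars_app.2 ⟨t, ht, hX⟩)
  | hatom a => simp
  | habs a t ih => simpa using ih (by simpa using h)
  | hsusp π Y => simp [h Y (by simp)]

/-! ### Representatives of pairs of terms modulo renaming -/

/-- An injective numbering of terms. -/
def codeTerm : NTerm → ℕ
  | .app f ts => Nat.pair 0 (Encodable.encode (f, ts.attach.map (fun x => codeTerm x.1)))
  | .atom a => Nat.pair 1 a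
  | .abs a t => Nat.pair 2 (Nat.pair a (codeTerm t))
  | .susp π X => Nat.pair 3 (Encodable.encode (π, X))
decreasing_by
  all_goals (simp_wf; try omega)
  all_goals (have := List.sizeOf_lt_of_mem x.2; omega)

theorem codeTerm_injective : Function.Injective codeTerm := by
  intro t
  induction t using NTerm.induct with
  | happ f ts ih =>
    intro s h
    cases s <;> simp only [codeTerm, Nat.pair_eq_pair, Encodable.encode_inj, Prod.mk.injEq] at h
    case app g ss =>
      obtain ⟨-, rfl, h⟩ := h
      simp only [List.map_attach_eq_pmap, List.pmap_eq_map] at h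
      have hl : ts.length = ss.length := by simpa using congrArg List.length h
      congr 1
      refine List.ext_getElem hl fun i h₁ h₂ => ih _ (List.getElem_mem h₁) ?_
      have := List.getElem_of_eq h (i := i) (by simpa using h₁)
      simpa only [List.getElem_map] using this
    all_goals omega
  | hatom a =>
    intro s h
    cases s <;> simp only [codeTerm, Nat.pair_eq_pair] at h
    case atom b => rw [h.2]
    all_goals omega
  | habs a t ih =>
    intro s h
    cases s <;> simp only [codeTerm, Nat.pair_eq_pair] at h
    case abs b s => rw [h.2.1, ih h.2.2]
    all_goals omega
  | hsusp π X =>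
    intro s h
    cases s <;>
      simp only [codeTerm, Nat.pair_eq_pair, Encodable.encode_inj, Prod.mk.injEq] at h
    case susp ρ Y => rw [h.2.1, h.2.2]
    all_goals omega

instance : Countable NTerm := codeTerm_injective.countable

/-- Pairs of terms modulo simultaneous `A`-based renaming and α-equivalence. -/
def pairSetoid (A : Finset Atom) (Δ : Set (Atom × Var)) : Setoid (NTerm × NTerm) where
  r p q := ∃ π, permBased π A ∧ NAlpha Δ (permTerm π p.1) q.1 ∧ NAlpha Δ (permTerm π p.2) q.2
  iseqv := by
    refine ⟨fun p => ⟨[], permBased_nil A, ?_, ?_⟩, ?_, ?_⟩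
    · rw [permTerm_nil]; exact .refl _
    · rw [permTerm_nil]; exact .refl _
    · rintro p q ⟨π, hπ, h₁, h₂⟩
      exact ⟨permInv π, hπ.inv,
        (h₁.symm.permTerm _).trans (nAlpha_permInv_permTerm π _),
        (h₂.symm.permTerm _).trans (nAlpha_permInv_permTerm π _)⟩
    · rintro p q r ⟨π, hπ, h₁, h₂⟩ ⟨ρ, hρ, h₃, h₄⟩
      refine ⟨ρ ++ π, hρ.append hπ, ?_, ?_⟩
      · rw [permTerm_append]; exact (h₁.permTerm ρ).trans h₃
      · rw [permTerm_append]; exact (h₂.permTerm ρ).trans h₄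

/-- A naming `v` of pairs of terms by variables, together with substitutions recovering
from the name of a pair that pair up to an `A`-based renaming. -/
structure IsNaming (A : Finset Atom) (Δ : Set (Atom × Var)) (v : NTerm → NTerm → Var)
    (σ₁ σ₂ : NSubst) : Prop where
  exists_perm : ∀ t s, ∃ π, permBased π A ∧
    NAlpha Δ (permTerm π (σ₁ (v t s))) t ∧ NAlpha Δ (permTerm π (σ₂ (v t s))) s
  name_eq : ∀ {t s t' s' : NTerm} {π : NPerm}, permBased π A → NAlpha Δ t' (permTerm π t) →
    NAlpha Δ s' (permTerm π s) → v t' s' = v t s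

theorem exists_isNaming (A : Finset Atom) (Δ : Set (Atom × Var)) :
    ∃ v σ₁ σ₂, IsNaming A Δ v σ₁ σ₂ := by
  obtain ⟨e, he⟩ := exists_injective_nat (Quotient (pairSetoid A Δ))
  have : Nonempty (Quotient (pairSetoid A Δ)) := ⟨Quotient.mk _ (.atom 0, .atom 0)⟩
  have hinv : ∀ q, Function.invFun e (e q) = q := Function.leftInverse_invFun he
  refine ⟨fun t s => e (Quotient.mk _ (t, s)), fun n => (Function.invFun e n).out.1,
    fun n => (Function.invFun e n).out.2, fun t s => ?_, fun hπ ht hs => ?_⟩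
  · simp only [hinv]
    exact Quotient.mk_out (s := pairSetoid A Δ) (t, s)
  · exact congrArg e (Quotient.sound (s := pairSetoid A Δ) ⟨_, hπ, ht.symm, hs.symm⟩).symm

/-! ### Antiunifiers -/

/-- The pairs of terms whose antiunifiers are not suspensions. -/
def SameShape (A : Finset Atom) (Δ : Set (Atom × Var)) : NTerm → NTerm → Prop
  | .atom a, .atom b => a = b ∧ a ∈ A
  | .app f ts, .app g ss => f = g ∧ ts.length = ss.length
  | .abs a t, .abs b s => ∃ c ∈ A, NFresh Δ c (.abs a t) ∧ NFresh Δ c (.abs b s)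
  | _, _ => False

/-- `Antiunifier A Δ v σ₁ σ₂ t s g`: the term `g` generalizes `t` and `s` by keeping their
common structure and replacing the remaining subterms by suspensions of their names. -/
inductive Antiunifier (A : Finset Atom) (Δ : Set (Atom × Var)) (v : NTerm → NTerm → Var)
    (σ₁ σ₂ : NSubst) : NTerm → NTerm → NTerm → Prop
  | atom {a : Atom} : a ∈ A → Antiunifier A Δ v σ₁ σ₂ (.atom a) (.atom a) (.atom a)
  | app {f : Fn} {ts ss gs : List NTerm} (ht : ts.length = gs.length)
      (hs : ss.length = gs.length) :
      (∀ i (hi : i < gs.length), Antiunifier A Δ v σ₁ σ₂ ts[i] ss[i] gs[i]) →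
      Antiunifier A Δ v σ₁ σ₂ (.app f ts) (.app f ss) (.app f gs)
  | abs {a b c : Atom} {t s g : NTerm} : c ∈ A → NFresh Δ c (.abs a t) →
      NFresh Δ c (.abs b s) →
      Antiunifier A Δ v σ₁ σ₂ (permTerm [(c, a)] t) (permTerm [(c, b)] s) g →
      Antiunifier A Δ v σ₁ σ₂ (.abs a t) (.abs b s) (.abs c g)
  | susp {t s : NTerm} {π : NPerm} : ¬ SameShape A Δ t s → permBased π A →
      NAlpha Δ (permTerm π (σ₁ (v t s))) t → NAlpha Δ (permTerm π (σ₂ (v t s))) s →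
      Antiunifier A Δ v σ₁ σ₂ t s (.susp π (v t s))

/-- The freshness constraints with atoms in `A` satisfied by both substitutions. -/
def commonFresh (A : Finset Atom) (Δ : Set (Atom × Var)) (σ₁ σ₂ : NSubst) :
    Set (Atom × Var) :=
  {c | c.1 ∈ A ∧ NFresh Δ c.1 (σ₁ c.2) ∧ NFresh Δ c.1 (σ₂ c.2)}

section Antiunifier

variable {A : Finset Atom} {Δ : Set (Atom × Var)} {v : NTerm → NTerm → Var} {σ₁ σ₂ : NSubst}

theorem SameShape.of_nAlpha {t s t' s' : NTerm} {π : NPerm} (h : SameShape A Δ t s)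
    (hπ : permBased π A) (ht : NAlpha Δ t' (permTerm π t)) (hs : NAlpha Δ s' (permTerm π s)) :
    SameShape A Δ t' s' := by
  have hfr : ∀ {c : Atom} {t t' : NTerm}, NAlpha Δ t' (permTerm π t) → NFresh Δ c t →
      NFresh Δ (permAtom π c) t' := fun h hc => h.symm.nFresh (nFresh_permTerm.2 hc)
  cases t <;> cases s <;> simp only [SameShape] at h
  case atom.atom a b =>
    obtain ⟨rfl, ha⟩ := h
    rw [permTerm_atom] at ht hs
    cases ht
    cases hs
    exact ⟨rfl, hπ.permAtom_mem.2 ha⟩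
  case app.app f ts g ss =>
    rw [permTerm_app] at ht hs
    cases ht with
    | app hl _ =>
      cases hs with
      | app hl' _ =>
        rw [List.length_map] at hl hl'
        exact ⟨h.1, by rw [hl, hl', h.2]⟩
  case abs.abs a t b s =>
    obtain ⟨c, hc, hct, hcs⟩ := h
    have h₁ := hfr ht hct
    have h₂ := hfr hs hcs
    rw [permTerm_abs] at ht hs
    cases t' <;> cases s' <;> first | cases ht; done | cases hs; done | skip
    exact ⟨_, hπ.permAtom_mem.2 hc, h₁, h₂⟩

theorem sameShape_iff_of_nAlpha {t s t' s' : NTerm} {π : NPerm}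
    (hπ : permBased π A) (ht : NAlpha Δ t' (permTerm π t)) (hs : NAlpha Δ s' (permTerm π s)) :
    SameShape A Δ t' s' ↔ SameShape A Δ t s :=
  ⟨fun h => h.of_nAlpha hπ.inv
      ((nAlpha_permInv_permTerm π t).symm.trans (ht.symm.permTerm _))
      ((nAlpha_permInv_permTerm π s).symm.trans (hs.symm.permTerm _)),
    fun h => h.of_nAlpha hπ ht hs⟩

theorem IsNaming.exists_antiunifier (hv : IsNaming A Δ v σ₁ σ₂) (t s : NTerm) :
    ∃ g, Antiunifier A Δ v σ₁ σ₂ t s g := by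
  suffices ∀ t π s, ∃ g, Antiunifier A Δ v σ₁ σ₂ (permTerm π t) s g by
    simpa [permTerm_nil] using this t [] s
  clear t s
  intro t
  have leaf : ∀ t s, ¬ SameShape A Δ t s → ∃ g, Antiunifier A Δ v σ₁ σ₂ t s g := by
    intro t s h
    obtain ⟨ρ, hρ, h₁, h₂⟩ := hv.exists_perm t s
    exact ⟨_, .susp h hρ h₁ h₂⟩
  induction t using NTerm.induct with
  | happ f ts ih =>
    intro π s
    by_cases h : SameShape A Δ (permTerm π (.app f ts)) s
    swap
    · exact leaf _ _ h
    rw [permTerm_app] at h ⊢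
    cases s <;> simp only [SameShape] at h
    case app g ss =>
    obtain ⟨rfl, hl⟩ := h
    rw [List.length_map] at hl
    choose g hg using fun i : Fin ts.length => ih ts[i] (List.getElem_mem _) π ss[i]
    refine ⟨.app f (List.ofFn g), .app (by simp) (by simp [hl]) fun i hi => ?_⟩
    simpa using hg ⟨i, by simpa using hi⟩
  | hatom a =>
    intro π s
    by_cases h : SameShape A Δ (permTerm π (.atom a)) s
    swap
    · exact leaf _ _ h
    rw [permTerm_atom] at h ⊢
    cases s <;> simp only [SameShape] at h
    case atom b =>
    obtain ⟨rfl, ha⟩ := h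
    exact ⟨_, .atom ha⟩
  | habs a t ih =>
    intro π s
    by_cases h : SameShape A Δ (permTerm π (.abs a t)) s
    swap
    · exact leaf _ _ h
    rw [permTerm_abs] at h ⊢
    cases s <;> simp only [SameShape] at h
    case abs b s =>
    obtain ⟨c, hc, hct, hcs⟩ := h
    obtain ⟨g, hg⟩ := ih ([(c, permAtom π a)] ++ π) (permTerm [(c, b)] s)
    rw [permTerm_append] at hg
    exact ⟨_, .abs hc hct hcs hg⟩
  | hsusp ρ X =>
    intro π s
    refine leaf _ _ ?_
    rw [permTerm_susp]
    cases s <;> simp [SameShape]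

theorem Antiunifier.termBased {t s g : NTerm} (h : Antiunifier A Δ v σ₁ σ₂ t s g) :
    termBased g A := by
  induction h with
  | atom h => exact termBased_atom.2 h
  | app _ _ _ ih =>
    refine termBased_app.2 fun g hg => ?_
    obtain ⟨i, hi, rfl⟩ := List.getElem_of_mem hg
    exact ih i hi
  | abs hc _ _ _ ih => exact termBased_abs.2 ⟨hc, ih⟩
  | susp _ hπ _ _ => exact termBased_susp.2 hπ

theorem Antiunifier.nAlpha_substTerm {t s g : NTerm} (h : Antiunifier A Δ v σ₁ σ₂ t s g) :
    NAlpha Δ (substTerm σ₁ g) t ∧ NAlpha Δ (substTerm σ₂ g) s := by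
  induction h with
  | atom h => simpa using NAlpha.refl _
  | app ht hs _ ih =>
    simp only [substTerm_app]
    exact ⟨nAlpha_app_iff.2 ⟨rfl, by simp [ht], fun i hi => by
        simpa using (ih i (by simpa using hi)).1⟩,
      nAlpha_app_iff.2 ⟨rfl, by simp [hs], fun i hi => by
        simpa using (ih i (by simpa using hi)).2⟩⟩
  | abs _ hct hcs _ ih =>
    simp only [substTerm_abs]
    exact ⟨ih.1.abs_of_swap hct, ih.2.abs_of_swap hcs⟩
  | susp _ _ h₁ h₂ => simpa using ⟨h₁, h₂⟩

theorem Antiunifier.nFresh {t s g : NTerm} (h : Antiunifier A Δ v σ₁ σ₂ t s g) {a : Atom}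
    (ha : a ∈ A) (hat : NFresh Δ a t) (has : NFresh Δ a s) :
    NFresh (commonFresh A Δ σ₁ σ₂) a g := by
  induction h with
  | atom h => simpa using hat
  | app ht hs _ ih =>
    rw [nFresh_app] at *
    intro g hg
    obtain ⟨i, hi, rfl⟩ := List.getElem_of_mem hg
    exact ih i hi (hat _ (List.getElem_mem _)) (has _ (List.getElem_mem _))
  | @abs _ _ c _ _ _ _ hct hcs _ ih =>
    by_cases hac : a = c
    · exact nFresh_abs.2 (.inl hac)
    · exact nFresh_abs.2 (.inr (ih (nFresh_swap_body hac hat hct) (nFresh_swap_body hac has hcs)))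
  | susp _ hπ h₁ h₂ =>
    refine .susp ⟨hπ.inv.permAtom_mem.2 ha, ?_, ?_⟩
    · exact nFresh_permTerm'.1 (h₁.symm.nFresh hat)
    · exact nFresh_permTerm'.1 (h₂.symm.nFresh has)

/-- Antiunifiers are equivariant, and in particular unique, up to α-equivalence. -/
theorem Antiunifier.equivariant (hv : IsNaming A Δ v σ₁ σ₂) {t s g t' s' g' : NTerm}
    {π : NPerm} (h : Antiunifier A Δ v σ₁ σ₂ t s g) (hπ : permBased π A)
    (ht : NAlpha Δ t' (permTerm π t)) (hs : NAlpha Δ s' (permTerm π s))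
    (h' : Antiunifier A Δ v σ₁ σ₂ t' s' g') :
    NAlpha (commonFresh A Δ σ₁ σ₂) g' (permTerm π g) := by
  have hshape := sameShape_iff_of_nAlpha hπ ht hs
  induction h generalizing t' s' g' π with
  | atom ha =>
    rw [permTerm_atom] at *
    cases ht
    cases hs
    cases h' with
    | atom _ => exact .refl _
    | susp hn _ _ _ => exact absurd (hshape.2 ⟨rfl, ha⟩) hn
  | @app f ts ss gs htl hsl _ ih =>
    rw [permTerm_app] at *
    cases h' with
    | susp hn _ _ _ => exact absurd (hshape.2 ⟨rfl, htl.trans hsl.symm⟩) hn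
    | app htl' hsl' hg' =>
      obtain ⟨rfl, hl, ht⟩ := nAlpha_app_iff.1 ht
      obtain ⟨-, hl', hs⟩ := nAlpha_app_iff.1 hs
      rw [List.length_map] at hl hl'
      refine nAlpha_app_iff.2 ⟨rfl, by simp; omega, fun i hi => ?_⟩
      have h₁ := ht i (htl' ▸ hi)
      have h₂ := hs i (hsl' ▸ hi)
      rw [List.getElem_map] at *
      exact ih i (by omega) hπ h₁ h₂ (hg' i hi) (sameShape_iff_of_nAlpha hπ h₁ h₂)
    | atom _ => cases ht
    | abs _ _ _ _ => cases ht
  | @abs a b c t s g hc hct hcs hg ih =>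
    have htf : ∀ {d}, NFresh Δ d t' → NFresh Δ (permAtom (permInv π) d) (.abs a t) :=
      fun h => nFresh_permTerm'.1 (ht.nFresh h)
    have hsf : ∀ {d}, NFresh Δ d s' → NFresh Δ (permAtom (permInv π) d) (.abs b s) :=
      fun h => nFresh_permTerm'.1 (hs.nFresh h)
    rw [permTerm_abs] at *
    cases h' with
    | susp hn _ _ _ => exact absurd (hshape.2 ⟨c, hc, hct, hcs⟩) hn
    | app _ _ _ => cases ht
    | atom _ => cases ht
    | @abs a' b' c' t' s' g' hc' hct' hcs' hg' =>
      have key : ∀ {a a' : Atom} {t t' : NTerm}, NFresh Δ c (.abs a t) →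
          NFresh Δ c' (.abs a' t') → NAlpha Δ (.abs a' t') (.abs (permAtom π a) (permTerm π t)) →
          NAlpha Δ (permTerm [(c', a')] t')
            (permTerm ([(c', permAtom π c)] ++ π) (permTerm [(c, a)] t)) := by
        intro a a' t t' hc hc' h
        refine (h.open_abs hc').trans ?_
        have hc'' := h.nFresh hc'
        rw [← permTerm_append, ← permTerm_append, nAlpha_permTerm_iff]
        intro x hx
        have h₁ : x = c → c = a := by
          rintro rfl
          exact (nFresh_abs.1 hc).resolve_right hx
        have h₂ : permAtom π x = c' → c' = permAtom π a := by
          rintro rfl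
          exact (nFresh_abs.1 hc'').resolve_right fun h => hx (nFresh_permTerm.1 h)
        have h₃ := fun y z => (permAtom_injective π).eq_iff (a := y) (b := z)
        simp only [permAtom_append, permAtom_cons, permAtom_nil, swapAtom]
        grind
      have hρ : permBased ([(c', permAtom π c)] ++ π) A :=
        permBased.append
          (permBased_cons.2 ⟨hc', hπ.permAtom_mem.2 hc, permBased_nil A⟩) hπ
      have h₁ := key hct hct' ht
      have h₂ := key hcs hcs' hs
      have h₃ := ih hρ h₁ h₂ hg' (sameShape_iff_of_nAlpha hρ h₁ h₂)
      rw [permTerm_append] at h₃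
      refine h₃.abs_of_swap ?_
      rw [← permTerm_abs, nFresh_permTerm']
      exact (Antiunifier.abs hc hct hcs hg).nFresh (hπ.inv.permAtom_mem.2 hc') (htf hct') (hsf hcs')
  | @susp t s ρ hn hρ h₁ h₂ =>
    have hn' := mt hshape.1 hn
    have leaf : ∃ ρ', g' = .susp ρ' (v t' s') ∧ permBased ρ' A ∧
        NAlpha Δ (permTerm ρ' (σ₁ (v t' s'))) t' ∧ NAlpha Δ (permTerm ρ' (σ₂ (v t' s'))) s' := by
      cases h' with
      | susp _ hρ' h₁' h₂' => exact ⟨_, rfl, hρ', h₁', h₂'⟩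
      | atom ha => exact absurd ⟨rfl, ha⟩ hn'
      | app htl hsl _ => exact absurd ⟨rfl, htl.trans hsl.symm⟩ hn'
      | abs hc hct hcs _ => exact absurd ⟨_, hc, hct, hcs⟩ hn'
    obtain ⟨ρ', rfl, hρ', h₁', h₂'⟩ := leaf
    rw [hv.name_eq hπ ht hs] at h₁' h₂' ⊢
    rw [permTerm_susp]
    have e₁ := h₁'.trans (ht.trans (h₁.symm.permTerm π))
    have e₂ := h₂'.trans (hs.trans (h₂.symm.permTerm π))
    rw [← permTerm_append, nAlpha_permTerm_iff] at e₁ e₂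
    refine .susp fun a ha => ⟨?_, ?_, ?_⟩
    · by_contra hA
      exact ha (by rw [hρ'.permAtom_of_notMem hA, (hπ.append hρ).permAtom_of_notMem hA])
    · exact not_not.1 fun h => ha (e₁ a h)
    · exact not_not.1 fun h => ha (e₂ a h)

/-- Every `A`-based term with `t` and `s` among its instances also has their antiunifier as
an instance. -/
theorem Antiunifier.nAlpha_of_instances (hv : IsNaming A Δ v σ₁ σ₂) {θ₁ θ₂ τ : NSubst}
    (hτ : ∀ X, Antiunifier A Δ v σ₁ σ₂ (θ₁ X) (θ₂ X) (τ X)) {r t s g : NTerm}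
    (hr : _root_.termBased r A) (ht : NAlpha Δ (substTerm θ₁ r) t)
    (hs : NAlpha Δ (substTerm θ₂ r) s) (h : Antiunifier A Δ v σ₁ σ₂ t s g) :
    NAlpha (commonFresh A Δ σ₁ σ₂) (substTerm τ r) g := by
  induction r using NTerm.induct generalizing t s g with
  | happ f rs ih =>
    rw [substTerm_app] at *
    cases h with
    | susp hn _ _ _ =>
      cases ht with
      | app hl _ =>
        cases hs with
        | app hl' _ =>
          rw [List.length_map] at hl hl'
          exact absurd ⟨rfl, hl.symm.trans hl'⟩ hn
    | app htl hsl hg =>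
      obtain ⟨rfl, hl, ht⟩ := nAlpha_app_iff.1 ht
      obtain ⟨-, hl', hs⟩ := nAlpha_app_iff.1 hs
      rw [List.length_map] at hl hl'
      refine nAlpha_app_iff.2 ⟨rfl, by simp; omega, fun i hi => ?_⟩
      rw [List.length_map] at hi
      have h₁ := ht i (by simpa using hi)
      have h₂ := hs i (by simpa using hi)
      rw [List.getElem_map] at *
      exact ih _ (List.getElem_mem hi) (termBased_app.1 hr _ (List.getElem_mem hi)) h₁ h₂
        (hg i (by omega))
    | atom _ => cases ht
    | abs _ _ _ _ => cases ht
  | hatom a =>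
    rw [substTerm_atom] at *
    cases ht
    cases hs
    cases h with
    | atom _ => exact .refl _
    | susp hn _ _ _ => exact absurd ⟨rfl, termBased_atom.1 hr⟩ hn
  | habs c r ih =>
    rw [termBased_abs] at hr
    have hct := (ht.nFresh (a := c) (by simp))
    have hcs := (hs.nFresh (a := c) (by simp))
    rw [substTerm_abs] at *
    cases t with
    | app _ _ | atom _ | susp _ _ => cases ht
    | abs a t =>
      cases s with
      | app _ _ | atom _ | susp _ _ => cases hs
      | abs b s =>
        obtain ⟨g₁, hg₁⟩ := hv.exists_antiunifier (permTerm [(c, a)] t) (permTerm [(c, b)] s)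
        have h₁ := (nAlpha_swap_self c _).symm.trans (ht.open_abs .abs1)
        have h₂ := (nAlpha_swap_self c _).symm.trans (hs.open_abs .abs1)
        have e := h.equivariant hv (permBased_nil A) (by rw [permTerm_nil]; exact .refl _)
          (by rw [permTerm_nil]; exact .refl _) (Antiunifier.abs hr.1 hct hcs hg₁)
        rw [permTerm_nil] at e
        exact (NAlpha.abs1 (ih hr.2 h₁ h₂ hg₁)).trans e
  | hsusp ρ X =>
    rw [substTerm_susp] at *
    exact ((hτ X).equivariant hv (termBased_susp.1 hr) ht.symm hs.symm h).symm

end Antiunifier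

open Classical in
/-- Any two terms-in-context have a greatest `A`-based generalization. -/
theorem exists_greatest_generalization (A : Finset Atom) (Δ : FCtx) (t s : NTerm) :
    ∃ p : TIC, ticBased p A ∧ IsGen p (Δ, t) (Δ, s) ∧
      ∀ p' : TIC, ticBased p' A → IsGen p' (Δ, t) (Δ, s) → TIC.Le p' p := by
  obtain ⟨v, σ₁, σ₂, hv⟩ := exists_isNaming A (↑Δ : Set (Atom × Var))
  obtain ⟨g, hg⟩ := hv.exists_antiunifier t s
  set Γ : FCtx := (A ×ˢ termVars g).filter (· ∈ commonFresh A (↑Δ) σ₁ σ₂) with hΓ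
  have hmem : ∀ c ∈ Γ, c ∈ commonFresh A (↑Δ) σ₁ σ₂ := fun c hc => (Finset.mem_filter.1 hc).2
  have hres : ∀ c ∈ commonFresh A (↑Δ) σ₁ σ₂, c.2 ∈ termVars g →
      c ∈ (↑Γ : Set (Atom × Var)) := by
    intro c hc hcg
    simp only [hΓ, Finset.coe_filter, Finset.mem_product, Set.mem_ofPred_eq]
    exact ⟨⟨hc.1, hcg⟩, hc⟩
  refine ⟨(Γ, g), ⟨?_, hg.termBased⟩, ⟨?_, ?_⟩, ?_⟩
  · intro a ha
    obtain ⟨c, hc, rfl⟩ := Finset.mem_image.1 ha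
    exact (hmem c hc).1
  · exact ⟨σ₁, fun a X h => (hmem _ h).2.1.notMem_FAnoSusp, fun c hc => (hmem c hc).2.1,
      hg.nAlpha_substTerm.1⟩
  · exact ⟨σ₂, fun a X h => (hmem _ h).2.2.notMem_FAnoSusp, fun c hc => (hmem c hc).2.2,
      hg.nAlpha_substTerm.2⟩
  · rintro ⟨Γ', r⟩ ⟨hΓ', hr⟩ ⟨⟨θ₁, -, hθ₁, ht⟩, ⟨θ₂, -, hθ₂, hs⟩⟩
    choose τ hτ using fun X => hv.exists_antiunifier (θ₁ X) (θ₂ X)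
    have hα := hg.nAlpha_of_instances hv hτ hr ht hs
    set τ' : NSubst := fun X => if X ∈ termVars r then τ X else .app 0 [] with hτ'
    have hfresh : ∀ c ∈ Γ', NFresh (↑Γ : Set (Atom × Var)) c.1 (τ' c.2) := by
      intro c hc
      by_cases hX : c.2 ∈ termVars r
      · simp only [hτ', hX, if_true]
        refine ((hτ c.2).nFresh (hΓ' (Finset.mem_image_of_mem _ hc)) (hθ₁ c hc)
          (hθ₂ c hc)).restrict hres ?_
        exact hα.termVars_eq ▸ termVars_subset_substTerm hX
      · simp [hτ', hX]
    refine ⟨τ', fun a X h => (hfresh _ h).notMem_FAnoSusp, hfresh, ?_⟩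
    have : substTerm τ' r = substTerm τ r := substTerm_congr fun X hX => by simp [hτ', hX]
    rw [this]
    exact hα.restrict hres subset_rfl

/-- `A`-based nominal anti-unification is unitary: any two
`A`-based terms-in-context `⟨Δ, t⟩` and `⟨Δ, s⟩` have an `A`-based least
general generalization, which is unique modulo `≃`. -/
theorem nau_unitary (A : Finset Atom) (Δ : FCtx) (t s : NTerm)
    (ht : termBased t A) (hs : termBased s A) (hΔ : ctxBased Δ A) :
    ∃ p : TIC, IsABasedLgg A p (Δ, t) (Δ, s) ∧
      ∀ p' : TIC, IsABasedLgg A p' (Δ, t) (Δ, s) → TIC.Equiv p p' := by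
  obtain ⟨p, hb, hp, hmax⟩ := exists_greatest_generalization A Δ t s
  refine ⟨p, ⟨hb, hp, fun ⟨p', hb', hp', hlt⟩ => hlt.2 (hmax p' hb' hp')⟩, ?_⟩
  rintro p' ⟨hb', hp', hlgg⟩
  refine ⟨?_, hmax p' hb' hp'⟩
  by_contra hn
  exact hlgg ⟨p, hb, hp, hmax p' hb' hp', hn⟩
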